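/- For every natural number n ≥ 3, there exists an element S of the integral symplectic group Sp(2n, ℤ) of order exactly 4 such that Sp(2n, ℤ) is generated by the set of all conjugates of S. -/

import Mathlib

namespace SpGen
open Matrix

abbrev V (n : ℕ) := Fin n ⊕ Fin n → ℤ
abbrev G (n : ℕ) := Matrix.symplecticGroup (Fin n) ℤ
variable {n : ℕ}

/-- the symplectic form -/
def om (x y : V n) : ℤ := x ⬝ᵥ (J (Fin n) ℤ *ᵥ y)

lemma om_add_left (x y z : V n) : om (x + y) z = om x z + om y z := by simp [om]
lemma om_sub_left (x y z : V n) : om (x - y) z = om x z - om y z := by simp [om]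
lemma om_neg_left (x z : V n) : om (-x) z = - om x z := by simp [om]
lemma om_smul_left (m : ℤ) (x z : V n) : om (m • x) z = m * om x z := by
  rw [om, smul_dotProduct]; rfl
lemma om_add_right (x y z : V n) : om x (y + z) = om x y + om x z := by
  simp [om, mulVec_add]
lemma om_sub_right (x y z : V n) : om x (y - z) = om x y - om x z := by
  simp [om, mulVec_sub]
lemma om_neg_right (x z : V n) : om x (-z) = - om x z := by simp [om, mulVec_neg]
lemma om_smul_right (m : ℤ) (x z : V n) : om x (m • z) = m * om x z := by
  rw [om, mulVec_smul, dotProduct_smul]; rfl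

lemma om_swap (x y : V n) : om x y = - om y x := by
  have h : om y x = x ⬝ᵥ ((J (Fin n) ℤ)ᵀ *ᵥ y) := by
    rw [om, dotProduct_comm, mulVec_transpose, dotProduct_comm, dotProduct_comm x,
      ← dotProduct_mulVec]
  rw [h, J_transpose, neg_mulVec, dotProduct_neg, neg_neg, om]

lemma om_self (x : V n) : om x x = 0 := by have := om_swap x x; omega

lemma om_act (A : G n) (x y : V n) : om (A.1 *ᵥ x) (A.1 *ᵥ y) = om x y := by
  have h := SymplecticGroup.mem_iff'.1 A.2
  unfold om
  conv_rhs => rw [← h]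
  rw [← mulVec_mulVec, ← mulVec_mulVec, dotProduct_mulVec x, vecMul_transpose]

lemma sp_ext {A B : G n} (h : ∀ x, A.1 *ᵥ x = B.1 *ᵥ x) : A = B :=
  Subtype.ext (Matrix.mulVec_injective (funext h))

def Tmat (u : V n) (m : ℤ) : Matrix (Fin n ⊕ Fin n) (Fin n ⊕ Fin n) ℤ :=
  1 + m • vecMulVec u (J (Fin n) ℤ *ᵥ u)

lemma Tmat_act (u : V n) (m : ℤ) (x : V n) : Tmat u m *ᵥ x = x + (m * om x u) • u := by
  rw [Tmat, add_mulVec, one_mulVec, smul_mulVec, vecMulVec_mulVec, om, dotProduct_comm x]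
  ext i; simp; ring

lemma Tmat_mem (u : V n) (m : ℤ) : Tmat u m ∈ symplecticGroup (Fin n) ℤ := by
  rw [SymplecticGroup.mem_iff']
  have key : ∀ x y : V n, x ⬝ᵥ (((Tmat u m)ᵀ * J (Fin n) ℤ * Tmat u m) *ᵥ y) = om x y := by
    intro x y
    have : x ⬝ᵥ (((Tmat u m)ᵀ * J (Fin n) ℤ * Tmat u m) *ᵥ y)
        = om (Tmat u m *ᵥ x) (Tmat u m *ᵥ y) := by
      unfold om
      rw [← mulVec_mulVec, ← mulVec_mulVec, dotProduct_mulVec x, vecMul_transpose]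
    rw [this, Tmat_act, Tmat_act]
    simp only [om_add_left, om_add_right, om_smul_left, om_smul_right, om_self]
    rw [om_swap u y]; ring
  ext i j
  have := key (Pi.single i 1) (Pi.single j 1)
  simpa [om] using this

/-- transvections -/
def T (u : V n) (m : ℤ) : G n := ⟨Tmat u m, Tmat_mem u m⟩

lemma T_act (u : V n) (m : ℤ) (x : V n) : (T u m).1 *ᵥ x = x + (m * om x u) • u :=
  Tmat_act u m x

lemma mul_act (A B : G n) (x : V n) : (A * B).1 *ᵥ x = A.1 *ᵥ (B.1 *ᵥ x) := by
  simp [mulVec_mulVec]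

lemma one_act (x : V n) : (1 : G n).1 *ᵥ x = x := by simp

lemma inv_act (A : G n) (x : V n) : A.1 *ᵥ ((A⁻¹).1 *ᵥ x) = x := by
  rw [← mul_act, mul_inv_cancel, one_act]

lemma T_add (u : V n) (m k : ℤ) : T u (m + k) = T u m * T u k := by
  apply sp_ext; intro x
  simp only [mul_act, T_act, om_add_left, om_smul_left, om_self]
  ext i; simp; ring

lemma T_zero (u : V n) : T u 0 = 1 := by
  apply sp_ext; intro x
  simp [T_act]

lemma T_neg (u : V n) (m : ℤ) : T (-u) m = T u m := by
  apply sp_ext; intro x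
  simp [T_act, om_neg_right]

lemma T_inv (u : V n) (m : ℤ) : T u (-m) = (T u m)⁻¹ := by
  apply eq_inv_of_mul_eq_one_left
  rw [← T_add]; simp [T_zero]

lemma T_mem (N : Subgroup (G n)) (u : V n) (h : T u 1 ∈ N) (m : ℤ) : T u m ∈ N := by
  induction m using Int.induction_on with
  | zero => rw [T_zero]; exact N.one_mem
  | succ i ih => rw [T_add]; exact N.mul_mem ih h
  | pred i ih => rw [sub_eq_add_neg, T_add, T_inv u 1]; exact N.mul_mem ih (N.inv_mem h)

lemma T_conj (g : G n) (u : V n) (m : ℤ) : g * T u m * g⁻¹ = T (g.1 *ᵥ u) m := by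
  apply sp_ext; intro x
  simp only [mul_act, T_act, mulVec_add, mulVec_smul]
  rw [inv_act]
  conv_rhs => rw [← inv_act g x, om_act]
  rw [inv_act]

/-- rotation in a hyperbolic plane -/
def S (a b : V n) : G n := T a 1 * T b 1 * T a 1

lemma S_act (a b : V n) (h : om a b = 1) (x : V n) :
    (S a b).1 *ᵥ x = x + (om x b) • (b - a) + (om x a) • (b + a) := by
  have h' : om b a = -1 := by rw [om_swap, h]
  simp only [S, mul_act, T_act, om_add_left, om_smul_left, om_self, h, h']
  ext i; simp; ring

lemma S_left (a b : V n) (h : om a b = 1) : (S a b).1 *ᵥ a = b := by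
  rw [S_act a b h, h, om_self]; simp
lemma S_right (a b : V n) (h : om a b = 1) : (S a b).1 *ᵥ b = -a := by
  have h' : om b a = -1 := by rw [om_swap, h]
  rw [S_act a b h, h', om_self]; simp

lemma S_sq_act (a b : V n) (h : om a b = 1) (x : V n) :
    (S a b ^ 2).1 *ᵥ x = x - (2 * om x b) • a + (2 * om x a) • b := by
  have h' : om b a = -1 := by rw [om_swap, h]
  rw [pow_two, mul_act, S_act a b h, S_act a b h]
  simp only [om_add_left, om_sub_left, om_smul_left, om_self, h, h']
  ext i; simp; ring

lemma S_order (a b : V n) (h : om a b = 1) : orderOf (S a b) = 4 := by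
  have h' : om b a = -1 := by rw [om_swap, h]
  have := orderOf_eq_prime_pow (p := 2) (n := 1) (x := S a b) ?_ ?_
  · simpa using this
  · intro h1
    rw [pow_one] at h1
    have h2 := S_sq_act a b h a
    rw [h1, one_act, h, om_self] at h2
    have h3 : om a b = om (a - (2 * 1 : ℤ) • a + (2 * 0 : ℤ) • b) b := by rw [← h2]
    simp only [om_add_left, om_sub_left, om_smul_left, om_self, h] at h3
    omega
  · have : (2:ℕ) ^ (1 + 1) = 2 * 2 := rfl
    rw [this, pow_mul]
    apply sp_ext; intro x
    rw [pow_two (S a b ^ 2), mul_act, S_sq_act a b h, S_sq_act a b h, one_act]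
    simp only [om_add_left, om_sub_left, om_smul_left, om_self, h, h']
    ext i; simp; ring

def P (N : Subgroup (G n)) (a b : V n) : Prop := om a b = 1 ∧ S a b ∈ N

variable {N : Subgroup (G n)}

lemma S_conj (g : G n) (a b : V n) : g * S a b * g⁻¹ = S (g.1 *ᵥ a) (g.1 *ᵥ b) := by
  simp only [S, ← T_conj]; group

lemma P_act (hN : N.Normal) {a b : V n} (h : P N a b) (g : G n) :
    P N (g.1 *ᵥ a) (g.1 *ᵥ b) :=
  ⟨by rw [om_act, h.1], by rw [← S_conj]; exact hN.conj_mem _ h.2 g⟩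

lemma P_flip (hN : N.Normal) {a b : V n} (h : P N a b) : P N b (-a) := by
  have := P_act hN h (S a b)
  rwa [S_left a b h.1, S_right a b h.1] at this

lemma P_neg {a b : V n} (h : P N a b) : P N (-a) (-b) := by
  refine ⟨by simp [om_neg_left, om_neg_right, h.1], ?_⟩
  simpa [S, T_neg] using h.2

lemma P_change (hN : N.Normal) {x y z : V n} (h : P N x y) (hz : om x z = 1) : P N x z := by
  have hyx : om y x = -1 := by rw [om_swap, h.1]
  have hzx : om z x = -1 := by rw [om_swap, hz]
  have hxx := om_self x
  set m := om y z - 1 with hm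
  have h1 := P_act hN h (T x m)
  have e1 : (T x m).1 *ᵥ x = x := by rw [T_act, om_self]; simp
  have e2 : (T x m).1 *ᵥ y = y - m • x := by rw [T_act, hyx]; simp [sub_eq_add_neg]
  rw [e1, e2] at h1
  set w := y - m • x with hw
  have hwz : om w z = 1 := by
    rw [hw, om_sub_left, om_smul_left, hz]; omega
  have h2 := P_act hN h1 (T (w - z) 1)
  have e3 : (T (w - z) 1).1 *ᵥ x = x := by
    rw [T_act, om_sub_right, h1.1, hz]; simp
  have e4 : (T (w - z) 1).1 *ᵥ w = z := by
    rw [T_act, om_sub_right, om_self, hwz]; simp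
  rwa [e3, e4] at h2

lemma P_quot (hN : N.Normal) {a b : V n} (h : P N a b) :
    QuotientGroup.mk' N (T b 1) = QuotientGroup.mk' N (T a 1) := by
  have h1 := T_conj (S a b) a 1
  rw [S_left a b h.1] at h1
  have h2 : QuotientGroup.mk' N (S a b) = 1 := by simpa using h.2
  rw [← h1, map_mul, map_mul, map_inv, h2]; simp

lemma P_cube (hN : N.Normal) {a b : V n} (h : P N a b) :
    QuotientGroup.mk' N (T a 1) ^ 3 = 1 := by
  have h2 : QuotientGroup.mk' N (S a b) = 1 := by simpa using h.2
  rw [S, map_mul, map_mul, P_quot hN h] at h2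
  rw [← h2, pow_succ, pow_two]

lemma T_parallelogram (a c : V n) (h : om a c = 0) :
    T (a + c) 1 * T (a - c) 1 = T a 1 * T a 1 * (T c 1 * T c 1) := by
  have h' : om c a = 0 := by rw [om_swap, h]; rfl
  apply sp_ext; intro x
  simp only [mul_act, T_act, om_add_left, om_sub_left, om_add_right, om_sub_right,
    om_smul_left, om_self, h, h']
  ext i; simp; ring

lemma first_mem (hN : N.Normal) {a b c d : V n} (h : P N a b) (hcd : om c d = 1)
    (hac : om a c = 0) (hbc : om b c = 0) (hbd : om b d = 0) :
    T a 1 ∈ N := by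
  have hdc : om d c = -1 := by rw [om_swap, hcd]
  have hba : om b a = -1 := by rw [om_swap, h.1]
  have p1 : P N a (b - c) := P_change hN h (by rw [om_sub_right, h.1, hac]; rfl)
  have p2 : P N (b - c) (-d) := P_change hN (P_flip hN p1)
    (by rw [om_neg_right, om_sub_left, hbd, hcd]; rfl)
  have p3 : P N (-d) c := P_change hN (P_flip hN p2) (by rw [om_neg_left, hdc]; rfl)
  have p4 : P N b (-(a + c)) := P_change hN (P_flip hN h)
    (by rw [om_neg_right, om_add_right, hba, hbc]; rfl)
  have p5 : P N b (-(a - c)) := P_change hN (P_flip hN h)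
    (by rw [om_neg_right, om_sub_right, hba, hbc]; rfl)
  have q0 := P_quot hN h
  have q1 := P_quot hN p1
  have q2 := P_quot hN p2
  have q3 := P_quot hN p3
  have q4 := P_quot hN p4
  have q5 := P_quot hN p5
  have q6 := P_cube hN h
  rw [T_neg] at q4 q5
  have q7 := congrArg (QuotientGroup.mk' N) (T_parallelogram a c hac)
  simp only [map_mul] at q7
  rw [q3, q2, q1, q4, q5, q0] at q7
  have : QuotientGroup.mk' N (T a 1) = 1 := by
    generalize QuotientGroup.mk' N (T a 1) = t at *
    have h2 : t * t = 1 := by simpa using q7.symm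
    rw [pow_succ, pow_two, h2, one_mul] at q6
    exact q6
  simpa using this

def Good (N : Subgroup (G n)) (v : V n) : Prop := (∃ y, P N v y) ∧ T v 1 ∈ N

lemma Good.next (hN : N.Normal) {v z : V n} (hv : Good N v) (h : om v z = 1) :
    Good N z ∧ S v z ∈ N := by
  obtain ⟨⟨y, hy⟩, hT⟩ := hv
  have p := P_change hN hy h
  refine ⟨⟨⟨_, P_flip hN p⟩, ?_⟩, p.2⟩
  have := P_quot hN p
  have h2 : QuotientGroup.mk' N (T v 1) = 1 := by simpa using hT
  rw [h2] at this
  simpa using this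

lemma Good.neg {v : V n} (hv : Good N v) : Good N (-v) :=
  ⟨hv.1.imp' _ (fun _ h => P_neg h), by rw [T_neg]; exact hv.2⟩

lemma Good.next' (hN : N.Normal) {v z : V n} (hv : Good N v) (h : om v z = 1 ∨ om v z = -1) :
    Good N z := by
  rcases h with h | h
  · exact (hv.next hN h).1
  · exact (hv.neg.next hN (by rw [om_neg_left, h]; rfl)).1

/-- basis -/
def bs (p : Fin n ⊕ Fin n) : V n := Pi.single p 1

lemma om_inl (v : V n) (i : Fin n) : om v (bs (Sum.inl i)) = v (Sum.inr i) := by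
  simp [om, bs, J, dotProduct, Matrix.one_apply]

lemma om_inr (v : V n) (i : Fin n) : om v (bs (Sum.inr i)) = - v (Sum.inl i) := by
  simp [om, bs, J, dotProduct, Matrix.one_apply]

def eps : Fin n ⊕ Fin n → ℤ := Sum.elim (fun _ => 1) (fun _ => -1)
def idx : Fin n ⊕ Fin n → ℕ := Sum.elim (fun i => i.1) (fun i => i.1)

lemma idx_swap (p : Fin n ⊕ Fin n) : idx p.swap = idx p := by cases p <;> rfl

lemma eps_cases (p : Fin n ⊕ Fin n) : eps p = 1 ∨ eps p = -1 := by cases p <;> simp [eps]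

lemma om_bs (v : V n) (p : Fin n ⊕ Fin n) : om v (bs p) = eps p * v p.swap := by
  cases p <;> simp [om_inl, om_inr, eps]

lemma bs_same (p : Fin n ⊕ Fin n) : (bs p : V n) p = 1 := by simp [bs]
lemma bs_ne {p q : Fin n ⊕ Fin n} (h : q ≠ p) : (bs p : V n) q = 0 := by simp [bs, h]

lemma good_basis (hN : N.Normal) (i0 : Fin n) (h : Good N (bs (Sum.inr i0)))
    (p : Fin n ⊕ Fin n) : Good N (bs p) := by
  have key : ∀ i, Good N (bs (Sum.inl i)) := by
    intro i
    have h1 : Good N (bs (Sum.inl i0) + bs (Sum.inr i)) := by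
      apply (h.next hN _).1
      rw [om_add_right, om_inl, om_inr, bs_same, bs_ne (by simp)]; rfl
    apply (h1.next hN _).1
    rw [om_inl, Pi.add_apply, bs_same, bs_ne (by simp)]; rfl
  cases p with
  | inl i => exact key i
  | inr i =>
    apply (key i).next' hN
    rw [om_inr, bs_same]; simp

lemma good_coord (hN : N.Normal) (hb : ∀ p, Good N (bs p)) {v : V n} (p : Fin n ⊕ Fin n)
    (h : v p = 1 ∨ v p = -1) : Good N v := by
  apply (hb p.swap).next' hN
  rw [om_swap, om_bs, Sum.swap_swap]
  rcases h with h | h <;> rcases eps_cases p.swap with h' | h' <;> simp [h, h']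

def Fix (k : ℕ) (g : G n) : Prop := ∀ p, idx p < k → g.1 *ᵥ (bs p) = bs p
def Low (k : ℕ) (v : V n) : Prop := ∀ p, idx p < k → om v (bs p) = 0

lemma Fix.mul {k : ℕ} {g h : G n} (hg : Fix k g) (hh : Fix k h) : Fix k (g * h) := by
  intro p hp; rw [mul_act, hh p hp, hg p hp]

lemma Low.act {k : ℕ} {g : G n} (hg : Fix k g) {v : V n} (hv : Low k v) :
    Low k (g.1 *ᵥ v) := by
  intro p hp
  rw [← hv p hp, ← om_act g v, hg p hp]

lemma Low.fix {k : ℕ} {u : V n} (hu : Low k u) (m : ℤ) : Fix k (T u m) := by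
  intro p hp
  rw [T_act, om_swap, hu p hp]; simp

lemma Low.fixS {k : ℕ} {u v : V n} (hu : Low k u) (hv : Low k v) : Fix k (S u v) :=
  ((hu.fix 1).mul (hv.fix 1)).mul (hu.fix 1)

lemma Low.add {k : ℕ} {u v : V n} (hu : Low k u) (hv : Low k v) : Low k (u + v) := by
  intro p hp; rw [om_add_left, hu p hp, hv p hp]; rfl

lemma Low.smul {k : ℕ} {u : V n} (hu : Low k u) (m : ℤ) : Low k (m • u) := by
  intro p hp; rw [om_smul_left, hu p hp, mul_zero]

lemma Low.coord {k : ℕ} {v : V n} (hv : Low k v) {p : Fin n ⊕ Fin n} (h : v p ≠ 0) :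
    k ≤ idx p := by
  by_contra hlt
  apply h
  have := hv p.swap (by rw [idx_swap]; omega)
  rw [om_bs, Sum.swap_swap] at this
  rcases eps_cases p.swap with h' | h' <;> simpa [h'] using this

lemma low_bs {k : ℕ} {p : Fin n ⊕ Fin n} (h : k ≤ idx p) : Low k (bs p) := by
  intro q hq
  rw [om_bs, bs_ne, mul_zero]
  intro h'
  rw [← h', idx_swap] at h; omega

/-- Two-step move of a signed basis vector to `bs (inl k)`. -/
lemma finish (hN : N.Normal) (hb : ∀ p, Good N (bs p)) (k : Fin n) (p : Fin n ⊕ Fin n)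
    (hp : k.1 ≤ idx p) (c : ℤ) (hc : c = 1 ∨ c = -1) :
    ∃ g ∈ N, Fix k.1 g ∧ g.1 *ᵥ (c • bs p) = bs (Sum.inl k) := by
  have hlow : Low k.1 (c • bs p : V n) := (low_bs hp).smul c
  have hgood : Good N (c • bs p) := good_coord hN hb p (by simpa [bs_same] using hc)
  have hk : Low k.1 (bs (Sum.inl k) : V n) := low_bs (le_refl _)
  have hk' : Low k.1 (bs (Sum.inr k) : V n) := low_bs (le_refl _)
  have main : ∀ z : V n, Low k.1 z → om (c • bs p) z = 1 → om z (bs (Sum.inl k)) = 1 →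
      ∃ g ∈ N, Fix k.1 g ∧ g.1 *ᵥ (c • bs p) = bs (Sum.inl k) := by
    intro z hz h1 h2
    obtain ⟨gz, m1⟩ := hgood.next hN h1
    obtain ⟨_, m2⟩ := gz.next hN h2
    refine ⟨S z (bs (Sum.inl k)) * S (c • bs p) z, N.mul_mem m2 m1,
      (hz.fixS hk).mul (hlow.fixS hz), ?_⟩
    rw [mul_act, S_left _ _ h1, S_left _ _ h2]
  cases p with
  | inr i =>
    apply main (bs (Sum.inr k) + c • bs (Sum.inl i)) (hk'.add (Low.smul (low_bs (p := Sum.inl i) hp) c))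
    · rw [om_add_right, om_smul_right, om_inr, om_inl]
      rcases hc with rfl | rfl <;> simp [bs]
    · rw [om_inl]; simp [bs]
  | inl i =>
    by_cases hik : i = k
    · subst hik
      rcases hc with rfl | rfl
      · exact ⟨1, N.one_mem, fun p _ => one_act _, by rw [one_act, one_smul]⟩
      · apply main (bs (Sum.inr i)) hk'
        · rw [om_inr]; simp [bs]
        · rw [om_inl]; simp [bs]
    · apply main (bs (Sum.inr k) + (-c) • bs (Sum.inr i)) (hk'.add (Low.smul (low_bs (p := Sum.inr i) hp) (-c)))
      · rw [om_add_right, om_smul_right, om_inr, om_inr]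
        have : k ≠ i := fun h => hik h.symm
        rcases hc with rfl | rfl <;> simp [bs, this]
      · rw [om_inl]
        have : k ≠ i := fun h => hik h.symm
        simp [bs, this]

def wt (v : V n) : ℕ := ∑ p, (v p).natAbs

lemma wt_lt (v : V n) (p : Fin n ⊕ Fin n) (c : ℤ) (h : (v p + c).natAbs < (v p).natAbs) :
    wt (v + c • bs p) < wt v := by
  apply Finset.sum_lt_sum
  · intro q _
    by_cases hq : q = p
    · subst hq; simpa [bs] using h.le
    · simp [bs, hq]
  · exact ⟨p, Finset.mem_univ _, by simpa [bs] using h⟩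

lemma exists_sign (x y : ℤ) (hy : y ≠ 0) (h : y.natAbs ≤ x.natAbs) :
    ∃ d : ℤ, (x + d * y).natAbs < x.natAbs := by
  rcases le_total 0 x with hx | hx <;> rcases le_total 0 y with hy' | hy'
  · exact ⟨-1, by omega⟩
  · exact ⟨1, by omega⟩
  · exact ⟨1, by omega⟩
  · exact ⟨-1, by omega⟩

lemma eps_sq (p : Fin n ⊕ Fin n) : eps p * eps p = 1 := by
  rcases eps_cases p with h | h <;> simp [h]

lemma moveA {k : ℕ} (hb : ∀ p, Good N (bs p)) {v : V n} (hv : Low k v) (p : Fin n ⊕ Fin n)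
    (h0 : v p ≠ 0) (h1 : v p.swap ≠ 0) (hle : (v p.swap).natAbs ≤ (v p).natAbs) :
    ∃ g ∈ N, Fix k g ∧ wt (g.1 *ᵥ v) < wt v := by
  obtain ⟨d, hd⟩ := exists_sign _ _ h1 hle
  refine ⟨T (bs p) (d * eps p), T_mem _ _ (hb p).2 _, (low_bs (hv.coord h0)).fix _, ?_⟩
  rw [T_act, om_bs]
  apply wt_lt
  have : d * eps p * (eps p * v p.swap) = d * v p.swap := by
    linear_combination (d * v p.swap) * eps_sq p
  rwa [this]

lemma moveB (hN : N.Normal) {k : ℕ} (hb : ∀ p, Good N (bs p)) {v : V n} (hv : Low k v)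
    (p q : Fin n ⊕ Fin n) (hpq : p ≠ q) (hpq' : q.swap ≠ p)
    (h0 : v p ≠ 0) (h1 : v q ≠ 0) (h2 : v p.swap = 0) (hle : (v q).natAbs ≤ (v p).natAbs) :
    ∃ g ∈ N, Fix k g ∧ wt (g.1 *ᵥ v) < wt v := by
  obtain ⟨d, hd⟩ := exists_sign _ _ h1 hle
  set x : V n := bs q.swap with hx
  set y : V n := bs p with hy
  have lx : Low k x := low_bs (by rw [idx_swap]; exact hv.coord h1)
  have ly : Low k y := low_bs (hv.coord h0)
  have gxy : Good N (x + y) := good_coord hN hb p (by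
    left; rw [Pi.add_apply, hx, hy, bs_same, bs_ne (Ne.symm hpq')]; rfl)
  have oyx : om y x = 0 := by
    rw [hx, om_bs, Sum.swap_swap, hy, bs_ne (Ne.symm hpq), mul_zero]
  have oxy : om x y = 0 := by rw [om_swap, oyx]; rfl
  have ovy : om v y = 0 := by rw [hy, om_bs, h2, mul_zero]
  have ovx : om v x = eps q.swap * v q := by rw [hx, om_bs, Sum.swap_swap]
  set m := d * eps q.swap with hm
  refine ⟨T (x + y) m * (T x (-m) * T y (-m)),
    N.mul_mem (T_mem _ _ gxy.2 _) (N.mul_mem (T_mem _ _ (hb _).2 _) (T_mem _ _ (hb _).2 _)),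
    ((lx.add ly).fix _).mul ((lx.fix _).mul (ly.fix _)), ?_⟩
  have e : (T (x + y) m * (T x (-m) * T y (-m))).1 *ᵥ v = v + (d * v q) • y := by
    have e1 : m * om v x = d * v q := by
      rw [ovx, hm]; linear_combination (d * v q) * eps_sq q.swap
    rw [← e1]
    simp only [mul_act, T_act, om_add_left, om_add_right, om_smul_left, om_self, oxy, oyx, ovy]
    ext i; simp
  rw [e]
  exact wt_lt _ _ _ hd

lemma reduce (hN : N.Normal) (hb : ∀ p, Good N (bs p)) (k : Fin n) (M : ℕ) :
    ∀ v : V n, wt v ≤ M → Low k.1 v → (∃ z, om v z = 1) →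
      ∃ g ∈ N, Fix k.1 g ∧ g.1 *ᵥ v = bs (Sum.inl k) := by
  induction M using Nat.strong_induction_on with
  | _ M ih =>
  intro v hM hv hz
  have step : (∃ g ∈ N, Fix k.1 g ∧ wt (g.1 *ᵥ v) < wt v) →
      ∃ g ∈ N, Fix k.1 g ∧ g.1 *ᵥ v = bs (Sum.inl k) := by
    rintro ⟨g, gN, gF, glt⟩
    obtain ⟨z, hz⟩ := hz
    obtain ⟨h, hN', hF, he⟩ := ih (wt (g.1 *ᵥ v)) (by omega) (g.1 *ᵥ v) le_rfl (hv.act gF)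
      ⟨g.1 *ᵥ z, by rw [om_act, hz]⟩
    exact ⟨h * g, N.mul_mem hN' gN, hF.mul gF, by rw [mul_act, he]⟩
  by_cases hA : ∃ p, v p ≠ 0 ∧ v p.swap ≠ 0
  · obtain ⟨p, h0, h1⟩ := hA
    apply step
    rcases le_total (v p.swap).natAbs (v p).natAbs with h | h
    · exact moveA hb hv p h0 h1 h
    · exact moveA hb hv p.swap h1 (by rwa [Sum.swap_swap]) (by rwa [Sum.swap_swap])
  push Not at hA
  by_cases hB : ∃ p q, p ≠ q ∧ v p ≠ 0 ∧ v q ≠ 0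
  · obtain ⟨p, q, hpq, h0, h1⟩ := hB
    apply step
    have n1 : q.swap ≠ p := fun h => h0 (by rw [← h]; exact hA q h1)
    have n2 : p.swap ≠ q := fun h => h1 (by rw [← h]; exact hA p h0)
    rcases le_total (v q).natAbs (v p).natAbs with h | h
    · exact moveB hN hb hv p q hpq n1 h0 h1 (hA p h0) h
    · exact moveB hN hb hv q p hpq.symm n2 h1 h0 (hA q h1) h
  push Not at hB
  obtain ⟨z, hz⟩ := hz
  have hex : ∃ p, v p ≠ 0 := by
    by_contra hcon
    push Not at hcon
    have : v = 0 := funext hcon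
    rw [this] at hz
    simp [om] at hz
  obtain ⟨p, hp⟩ := hex
  have hv' : v = v p • bs p := by
    ext q
    by_cases hq : q = p
    · subst hq; simp [bs]
    · simp only [Pi.smul_apply, bs_ne hq, smul_zero]
      by_contra h
      exact hp (by_contra fun h' => h (hB p q (Ne.symm hq) h'))
  have hc : v p = 1 ∨ v p = -1 := by
    rw [hv', om_smul_left] at hz
    exact Int.isUnit_iff.1 (IsUnit.of_mul_eq_one _ hz)
  rw [hv']
  exact finish hN hb k p (hv.coord hp) (v p) hc

lemma step_fix (hN : N.Normal) (hb : ∀ p, Good N (bs p)) (k : Fin n) (A : G n)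
    (hA : Fix k.1 A) : ∃ g ∈ N, Fix (k.1 + 1) (g * A) := by
  set e : V n := bs (Sum.inl k) with he
  set f : V n := bs (Sum.inr k) with hf
  have le : Low k.1 e := low_bs (le_refl _)
  have lf : Low k.1 f := low_bs (le_refl _)
  have ofe : om f e = 1 := by rw [he, hf, om_inl, bs_same]
  have oef : om e f = -1 := by rw [om_swap, ofe]
  obtain ⟨g, gN, gF, ge⟩ := reduce hN hb k _ (A.1 *ᵥ e) le_rfl (le.act hA)
    ⟨A.1 *ᵥ (-f), by rw [om_act, om_neg_right, oef]; rfl⟩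
  have hB : Fix k.1 (g * A) := gF.mul hA
  have hBe : (g * A).1 *ᵥ e = e := by rw [mul_act, ge]
  set w := (g * A).1 *ᵥ f with hw
  have lw : Low k.1 w := lf.act hB
  have owe : om w e = 1 := by
    rw [← ofe, ← om_act (g * A) f e, hBe]
  have oew : om e w = -1 := by rw [om_swap, owe]
  set m := om w f - 1 with hm
  set w' := w + m • e with hw'
  have ow'f : om w' f = 1 := by rw [hw', om_add_left, om_smul_left, oef]; omega
  have oew' : om e w' = -1 := by rw [hw', om_add_right, om_smul_right, om_self, oew]; omega
  have lw' : Low k.1 w' := lw.add (le.smul m)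
  set u := w' + (-1 : ℤ) • f with hu
  have lu : Low k.1 u := lw'.add (lf.smul _)
  have ouf : om u f = 1 := by rw [hu, om_add_left, om_smul_left, om_self, ow'f]; rfl
  have gu : Good N u := by
    apply (hb (Sum.inr k)).next' hN
    right
    rw [om_swap, ouf]
  have oeu : om e u = 0 := by rw [hu, om_add_right, om_smul_right, oef, oew']; rfl
  have ow'u : om w' u = -1 := by rw [hu, om_add_right, om_smul_right, om_self, ow'f]; rfl
  refine ⟨T u 1 * (T e m * g),
    N.mul_mem gu.2 (N.mul_mem (T_mem _ _ (hb _).2 _) gN), ?_⟩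
  have assoc : T u 1 * (T e m * g) * A = T u 1 * (T e m * (g * A)) := by group
  rw [assoc]
  have he' : (T u 1 * (T e m * (g * A))).1 *ᵥ e = e := by
    rw [mul_act, mul_act, hBe, T_act e, om_self, T_act]
    simp [oeu]
  have hf' : (T u 1 * (T e m * (g * A))).1 *ᵥ f = f := by
    rw [mul_act, mul_act, ← hw, T_act e, owe, mul_one, ← hw', T_act, ow'u, hu]
    ext i; simp
  intro p hp
  by_cases hlt : idx p < k.1
  · exact ((lu.fix 1).mul ((le.fix m).mul hB)) p hlt
  · cases p with
    | inl i =>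
      have : i = k := Fin.ext (by simp only [idx, Sum.elim_inl] at hp hlt; omega)
      subst this; exact he'
    | inr i =>
      have : i = k := Fin.ext (by simp only [idx, Sum.elim_inr] at hp hlt; omega)
      subst this; exact hf'

lemma all_fix (hN : N.Normal) (hb : ∀ p, Good N (bs p)) (A : G n) (k : ℕ) (hk : k ≤ n) :
    ∃ g ∈ N, Fix k (g * A) := by
  induction k with
  | zero => exact ⟨1, N.one_mem, fun p hp => absurd hp (Nat.not_lt_zero _)⟩
  | succ k ih =>
    obtain ⟨g, gN, gF⟩ := ih (by omega)
    obtain ⟨h, hN', hF⟩ := step_fix hN hb ⟨k, hk⟩ (g * A) gF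
    exact ⟨h * g, N.mul_mem hN' gN, by rw [mul_assoc]; exact hF⟩

lemma eq_top (hN : N.Normal) (hb : ∀ p, Good N (bs p)) : N = ⊤ := by
  rw [eq_top_iff]
  intro A _
  obtain ⟨g, gN, gF⟩ := all_fix hN hb A n le_rfl
  have : g * A = 1 := by
    apply Subtype.ext
    ext i j
    have h := gF j (by cases j <;> simp [idx])
    have h' := congrFun h i
    simpa [bs, Pi.single_apply, Matrix.one_apply] using h'
  have hA : A = g⁻¹ := (inv_eq_of_mul_eq_one_right this).symm
  rw [hA]; exact N.inv_mem gN

end SpGen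

/-- For every `n ≥ 3`, the symplectic group `Sp(2n, ℤ)` is generated by the
conjugates of a single element of order exactly `4`. -/
theorem symplectic_generated_by_conjugates_of_order_four
    (n : ℕ) (hn : 3 ≤ n) :
    ∃ S : Matrix.symplecticGroup (Fin n) ℤ,
      orderOf S = 4 ∧ Subgroup.normalClosure {S} = ⊤ := by
  let i0 : Fin n := ⟨0, by omega⟩
  let i1 : Fin n := ⟨1, by omega⟩
  have h01 : i0 ≠ i1 := by simp [i0, i1]
  have hab : SpGen.om (SpGen.bs (Sum.inr i0)) (SpGen.bs (Sum.inl i0)) = 1 := by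
    rw [SpGen.om_inl, SpGen.bs_same]
  refine ⟨SpGen.S (SpGen.bs (Sum.inr i0)) (SpGen.bs (Sum.inl i0)), SpGen.S_order _ _ hab, ?_⟩
  have hN := Subgroup.normalClosure_normal
    (s := {SpGen.S (SpGen.bs (Sum.inr i0)) (SpGen.bs (Sum.inl i0))})
  have hP : SpGen.P (Subgroup.normalClosure
      {SpGen.S (SpGen.bs (Sum.inr i0)) (SpGen.bs (Sum.inl i0))})
      (SpGen.bs (Sum.inr i0)) (SpGen.bs (Sum.inl i0)) :=
    ⟨hab, Subgroup.subset_normalClosure rfl⟩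
  apply SpGen.eq_top hN
  apply SpGen.good_basis hN i0
  refine ⟨⟨_, hP⟩, SpGen.first_mem hN hP
    (c := SpGen.bs (Sum.inr i1)) (d := SpGen.bs (Sum.inl i1)) ?_ ?_ ?_ ?_⟩
  · rw [SpGen.om_inl, SpGen.bs_same]
  · rw [SpGen.om_inr, SpGen.bs_ne (by simp)]; rfl
  · rw [SpGen.om_inr, SpGen.bs_ne (by simpa using h01.symm)]; rfl
  · rw [SpGen.om_inl, SpGen.bs_ne (by simp)]
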